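/- arXiv:0810.2711 — 2 statements merged into one kernel-verified Lean document; each statement's English description precedes it below -/
import Mathlib

section
/- Let φ : [0,1]² → [0,1]² be a bi-Lipschitz bijection that fixes the four vertices (0,0), (1,0), (0,1), (1,1). Then there exists a bi-Lipschitz bijection Φ : [0,1]³ → [0,1]³ such that Φ(x,y,0) = (x,y,0) and Φ(x,y,1) = (φ(x,y), 1) for all (x,y) ∈ [0,1]²; i.e., every bi-Lipschitz self-homeomorphism of the square fixing the vertices is bi-Lipschitz isotopic to the identity through the unit cube. -/
/-- The unit square. -/
def USq : Set (ℝ × ℝ) := Set.Icc (0 : ℝ) 1 ×ˢ Set.Icc (0 : ℝ) 1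

lemma mem_USq {p : ℝ × ℝ} : p ∈ USq ↔ (0 ≤ p.1 ∧ p.1 ≤ 1) ∧ (0 ≤ p.2 ∧ p.2 ≤ 1) := by
  rw [USq, Set.mem_prod, Set.mem_Icc, Set.mem_Icc]

/-- A mutually inverse pair of Lipschitz self-maps of the square fixing the vertices. -/
structure GoodPair (φ ψ : ℝ × ℝ → ℝ × ℝ) (L : ℝ) : Prop where
  hL : 1 ≤ L
  m1 : ∀ p ∈ USq, φ p ∈ USq
  m2 : ∀ p ∈ USq, ψ p ∈ USq
  i1 : ∀ p ∈ USq, ψ (φ p) = p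
  i2 : ∀ p ∈ USq, φ (ψ p) = p
  l1 : ∀ p ∈ USq, ∀ q ∈ USq, dist (φ p) (φ q) ≤ L * dist p q
  l2 : ∀ p ∈ USq, ∀ q ∈ USq, dist (ψ p) (ψ q) ≤ L * dist p q
  v00 : φ (0, 0) = (0, 0)
  v10 : φ (1, 0) = (1, 0)
  v01 : φ (0, 1) = (0, 1)
  v11 : φ (1, 1) = (1, 1)

lemma GoodPair.symm {φ ψ : ℝ × ℝ → ℝ × ℝ} {L : ℝ} (h : GoodPair φ ψ L) : GoodPair ψ φ L where
  hL := h.hL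
  m1 := h.m2
  m2 := h.m1
  i1 := h.i2
  i2 := h.i1
  l1 := h.l2
  l2 := h.l1
  v00 := by
    have := h.i1 (0, 0) (by simp [mem_USq]); rwa [h.v00] at this
  v10 := by
    have := h.i1 (1, 0) (by simp [mem_USq]); rwa [h.v10] at this
  v01 := by
    have := h.i1 (0, 1) (by simp [mem_USq]); rwa [h.v01] at this
  v11 := by
    have := h.i1 (1, 1) (by simp [mem_USq]); rwa [h.v11] at this

lemma GoodPair.cont {φ ψ : ℝ × ℝ → ℝ × ℝ} {L : ℝ} (h : GoodPair φ ψ L) : ContinuousOn φ USq := by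
  have : LipschitzOnWith (Real.toNNReal L) φ USq := by
    apply LipschitzOnWith.of_dist_le_mul
    intro p hp q hq
    rw [Real.coe_toNNReal L (by linarith [h.hL])]
    exact h.l1 p hp q hq
  exact this.continuousOn

/-- A radial embedding of the circle into `ℂ \ {0}` has no continuous logarithm. -/
lemma no_log (r : ℝ) (hr : 0 < r) (g : Circle → ℂ) (hg : Continuous g)
    (h : ∀ z : Circle, Complex.exp (g z) = r * z) : False := by
  have hr' : (r : ℂ) ≠ 0 := by exact_mod_cast hr.ne'
  have key : ∀ z : Circle, Complex.exp (g z - g (-z)) = -1 := by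
    intro z
    have hz : (z : ℂ) ≠ 0 := Circle.coe_ne_zero z
    have e : ((-z : Circle) : ℂ) = -(z : ℂ) := rfl
    rw [Complex.exp_sub, h, h, e]
    field_simp
  let u : ℝ → ℝ := fun θ => (g (Circle.exp θ) - g (-Circle.exp θ)).im
  have hn : Continuous (fun z : Circle => -z) := by
    exact (continuous_subtype_val.neg).subtype_mk _
  have hu : Continuous u := by
    have h1 : Continuous fun θ : ℝ => g (Circle.exp θ) := hg.comp Circle.exp.continuous
    have h2 : Continuous fun θ : ℝ => g (-Circle.exp θ) :=
      hg.comp (hn.comp Circle.exp.continuous)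
    exact Complex.continuous_im.comp (h1.sub h2)
  have hpi : u Real.pi = - u 0 := by
    have e1 : Circle.exp Real.pi = -1 := by
      ext; simp [Circle.coe_exp]
    simp [u, e1]
  have hz : ∃ θ, u θ = 0 := by
    rcases le_total 0 (u 0) with h0 | h0
    · obtain ⟨θ, hθ⟩ := mem_range_of_exists_le_of_exists_ge hu ⟨Real.pi, by linarith⟩ ⟨0, h0⟩
      exact ⟨θ, hθ⟩
    · obtain ⟨θ, hθ⟩ := mem_range_of_exists_le_of_exists_ge hu ⟨0, h0⟩ ⟨Real.pi, by linarith⟩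
      exact ⟨θ, hθ⟩
  obtain ⟨θ, hθ⟩ := hz
  have k := key (Circle.exp θ)
  have hre := congrArg Complex.re k
  rw [Complex.exp_re] at hre
  have : (g (Circle.exp θ) - g (-Circle.exp θ)).im = 0 := hθ
  rw [this] at hre
  simp only [Real.cos_zero, mul_one, Complex.neg_re, Complex.one_re] at hre
  linarith [Real.exp_pos (g (Circle.exp θ) - g (-Circle.exp θ)).re]

lemma interior_map {φ ψ : ℝ × ℝ → ℝ × ℝ} {L : ℝ} (h : GoodPair φ ψ L) (p : ℝ × ℝ)
    (h1 : 0 < p.1) (h2 : p.1 < 1) (h3 : 0 < p.2) (h4 : p.2 < 1) :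
    (0 < (φ p).1 ∧ (φ p).1 < 1) ∧ (0 < (φ p).2 ∧ (φ p).2 < 1) := by
  by_contra hcon
  have hp : p ∈ USq := mem_USq.2 ⟨⟨h1.le, h2.le⟩, ⟨h3.le, h4.le⟩⟩
  have hq := mem_USq.1 (h.m1 p hp)
  obtain ⟨r, hr, r1, r2, r3, r4⟩ : ∃ r : ℝ, 0 < r ∧ r ≤ p.1 ∧ r ≤ 1 - p.1 ∧ r ≤ p.2 ∧
      r ≤ 1 - p.2 := by
    refine ⟨min (min p.1 (1 - p.1)) (min p.2 (1 - p.2)), ?_, ?_, ?_, ?_, ?_⟩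
    · simp only [lt_min_iff]; refine ⟨⟨?_, ?_⟩, ?_, ?_⟩ <;> linarith
    all_goals simp
  let c : Circle → ℝ × ℝ := fun z => (p.1 + r * (z : ℂ).re, p.2 + r * (z : ℂ).im)
  have hc : Continuous c := by
    have h0 : Continuous fun z : Circle => (z : ℂ) := continuous_subtype_val
    have h1 := Complex.continuous_re.comp h0
    have h2 := Complex.continuous_im.comp h0
    exact (continuous_const.add (continuous_const.mul h1)).prodMk
      (continuous_const.add (continuous_const.mul h2))
  have hcz : ∀ z : Circle, c z ∈ USq := by
    intro z
    have a := Complex.abs_re_le_norm (z : ℂ)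
    have b := Complex.abs_im_le_norm (z : ℂ)
    rw [Circle.norm_coe, abs_le] at a b
    rw [mem_USq]
    refine ⟨⟨?_, ?_⟩, ?_, ?_⟩ <;> simp only [c] <;> nlinarith
  have hcp : ∀ z : Circle, c z ≠ p := by
    intro z hz
    have e1 := congrArg Prod.fst hz
    have e2 := congrArg Prod.snd hz
    simp only [c] at e1 e2
    have a : (z : ℂ).re = 0 := by
      have : r * (z : ℂ).re = 0 := by linarith
      exact (mul_eq_zero.1 this).resolve_left hr.ne'
    have b : (z : ℂ).im = 0 := by
      have : r * (z : ℂ).im = 0 := by linarith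
      exact (mul_eq_zero.1 this).resolve_left hr.ne'
    exact Circle.coe_ne_zero z (Complex.ext a b)
  let k : unitInterval × Circle → ℝ × ℝ := fun a =>
    (1 / 2 + (a.1 : ℝ) * ((φ (c a.2)).1 - 1 / 2), 1 / 2 + (a.1 : ℝ) * ((φ (c a.2)).2 - 1 / 2))
  have hφc : Continuous fun z => φ (c z) := h.cont.comp_continuous hc hcz
  have hk : Continuous k := by
    have : Continuous fun a : unitInterval × Circle => φ (c a.2) := hφc.comp continuous_snd
    have ht : Continuous fun a : unitInterval × Circle => (a.1 : ℝ) :=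
      continuous_subtype_val.comp continuous_fst
    exact (continuous_const.add (ht.mul (this.fst.sub continuous_const))).prodMk
      (continuous_const.add (ht.mul (this.snd.sub continuous_const)))
  have hkS : ∀ a, k a ∈ USq := by
    intro a
    have w := mem_USq.1 (h.m1 _ (hcz a.2))
    have t0 := a.1.2.1
    have t1 := a.1.2.2
    rw [mem_USq]
    refine ⟨⟨?_, ?_⟩, ?_, ?_⟩ <;> simp only [k] <;> nlinarith
  have hkq : ∀ a, k a ≠ φ p := by
    intro a ha
    have w := mem_USq.1 (h.m1 _ (hcz a.2))
    have t0 := a.1.2.1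
    have t1 := a.1.2.2
    rcases t1.lt_or_eq with t1 | t1
    · apply hcon
      rw [← ha]
      refine ⟨⟨?_, ?_⟩, ?_, ?_⟩ <;> simp only [k] <;> nlinarith
    · have : φ (c a.2) = φ p := by
        rw [← ha]
        simp only [k, t1]
        ext <;> simp
      have e := congrArg ψ this
      rw [h.i1 _ (hcz _), h.i1 _ hp] at e
      exact hcp _ e
  have hψk : Continuous fun a => ψ (k a) := h.symm.cont.comp_continuous hk hkS
  have hψp : ∀ a, ψ (k a) ≠ p := by
    intro a ha
    apply hkq a
    rw [← ha, h.i2 _ (hkS a)]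
  let H0 : unitInterval × Circle → ℂ := fun a => ⟨(ψ (k a)).1 - p.1, (ψ (k a)).2 - p.2⟩
  have hH0 : Continuous H0 := by
    have : H0 = fun a => (((ψ (k a)).1 - p.1 : ℝ) : ℂ) + (((ψ (k a)).2 - p.2 : ℝ) : ℂ) * Complex.I := by
      funext a
      exact Complex.mk_eq_add_mul_I _ _
    rw [this]
    exact (Complex.continuous_ofReal.comp (hψk.fst.sub continuous_const)).add
      ((Complex.continuous_ofReal.comp (hψk.snd.sub continuous_const)).mul continuous_const)
  have hH0' : ∀ a, H0 a ≠ 0 := by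
    intro a ha
    apply hψp a
    have e1 := congrArg Complex.re ha
    have e2 := congrArg Complex.im ha
    simp only [H0, Complex.zero_re, Complex.zero_im] at e1 e2
    exact Prod.ext (by linarith) (by linarith)
  let H : C(unitInterval × Circle, {z : ℂ // z ≠ 0}) :=
    ⟨fun a => ⟨H0 a, hH0' a⟩, hH0.subtype_mk _⟩
  let f : C(Circle, ℂ) := ContinuousMap.const _ (Complex.log (H0 (0, 1)))
  have hf : ∀ z, H (0, z) = (fun z : ℂ ↦ (⟨_, z.exp_ne_zero⟩ : {z : ℂ // z ≠ 0})) (f z) := by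
    intro z
    apply Subtype.ext
    simp only [H, f, ContinuousMap.coe_mk, ContinuousMap.const_apply]
    rw [Complex.exp_log (hH0' _)]
    simp [H0, k]
  let G := Complex.isCoveringMap_exp.liftHomotopy H f hf
  have hG : ∀ a, Complex.exp (G a) = H0 a := by
    intro a
    have := congrFun (Complex.isCoveringMap_exp.liftHomotopy_lifts H f hf) a
    exact congrArg Subtype.val this
  refine no_log r hr (fun z => G (1, z)) (by fun_prop) ?_
  intro z
  rw [hG]
  have : k (1, z) = φ (c z) := by
    simp only [k]
    ext <;> simp
  simp only [H0, this, h.i1 _ (hcz z), c]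
  apply Complex.ext <;> simp

lemma bdry_map {φ ψ : ℝ × ℝ → ℝ × ℝ} {L : ℝ} (h : GoodPair φ ψ L) (p : ℝ × ℝ) (hp : p ∈ USq)
    (hb : p.1 = 0 ∨ p.1 = 1 ∨ p.2 = 0 ∨ p.2 = 1) :
    (φ p).1 = 0 ∨ (φ p).1 = 1 ∨ (φ p).2 = 0 ∨ (φ p).2 = 1 := by
  by_contra hcon
  push Not at hcon
  have w := mem_USq.1 (h.m1 p hp)
  obtain ⟨a, b, c, d⟩ := hcon
  have := interior_map h.symm (φ p) (lt_of_le_of_ne w.1.1 a.symm) (lt_of_le_of_ne w.1.2 b)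
    (lt_of_le_of_ne w.2.1 c.symm) (lt_of_le_of_ne w.2.2 d)
  rw [h.i1 p hp] at this
  rcases hb with hb | hb | hb | hb <;> linarith [this.1.1, this.1.2, this.2.1, this.2.2]

lemma diag_avoid {φ ψ : ℝ × ℝ → ℝ × ℝ} {L : ℝ} (h : GoodPair φ ψ L) (p : ℝ × ℝ) (hp : p ∈ USq)
    (hb : (p.1 = 0 ∨ p.1 = 1) ∧ (0 < p.2 ∧ p.2 < 1) ∨ (0 < p.1 ∧ p.1 < 1) ∧ (p.2 = 0 ∨ p.2 = 1)) :
    (φ p).1 - (φ p).2 ≠ 0 ∧ (φ p).1 + (φ p).2 - 1 ≠ 0 := by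
  have B := bdry_map h p hp (by tauto)
  have key : ∀ v : ℝ × ℝ, (v.1 = 0 ∨ v.1 = 1) → (v.2 = 0 ∨ v.2 = 1) → φ p ≠ v := by
    intro v v1 v2 e
    have e' := congrArg ψ e
    rw [h.i1 p hp] at e'
    have : ψ v = v := by
      obtain ⟨x, y⟩ := v
      simp only at v1 v2
      rcases v1 with rfl | rfl <;> rcases v2 with rfl | rfl
      exacts [h.symm.v00, h.symm.v01, h.symm.v10, h.symm.v11]
    rw [this] at e'
    subst e'
    rcases hb with ⟨-, b1, b2⟩ | ⟨⟨b1, b2⟩, -⟩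
    · rcases v2 with v2 | v2 <;> linarith
    · rcases v1 with v1 | v1 <;> linarith
  constructor <;> intro hd
  · rcases B with b | b | b | b
    · exact key (φ p) (by left; linarith) (by left; linarith) rfl
    · exact key (φ p) (by right; linarith) (by right; linarith) rfl
    · exact key (φ p) (by left; linarith) (by left; linarith) rfl
    · exact key (φ p) (by right; linarith) (by right; linarith) rfl
  · rcases B with b | b | b | b
    · exact key (φ p) (by left; linarith) (by right; linarith) rfl
    · exact key (φ p) (by right; linarith) (by left; linarith) rfl
    · exact key (φ p) (by right; linarith) (by left; linarith) rfl
    · exact key (φ p) (by left; linarith) (by right; linarith) rfl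

/-- A continuous function on `[0,1]` without zeros in `(0,1)` has the sign of its values at the
endpoints. -/
lemma sign_const (f : ℝ → ℝ) (hf : ContinuousOn f (Set.Icc 0 1))
    (h0 : ∀ s, 0 < s → s < 1 → f s ≠ 0) (e : ℝ) (he : e = 0 ∨ e = 1) (hneg : f e < 0)
    (s : ℝ) (s0 : 0 < s) (s1 : s < 1) : f s < 0 := by
  by_contra hs
  push Not at hs
  have hs' : 0 < f s := lt_of_le_of_ne hs (h0 s s0 s1).symm
  rcases he with rfl | rfl
  · have := intermediate_value_Ioo s0.le (hf.mono (Set.Icc_subset_Icc le_rfl s1.le))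
    obtain ⟨x, hx, hx0⟩ := this ⟨hneg, hs'⟩
    exact h0 x hx.1 (hx.2.trans s1) hx0
  · have := intermediate_value_Ioo' s1.le (hf.mono (Set.Icc_subset_Icc s0.le le_rfl))
    obtain ⟨x, hx, hx0⟩ := this ⟨hneg, hs'⟩
    exact h0 x (s0.trans hx.1) hx.2 hx0

lemma edge_aux {φ ψ : ℝ × ℝ → ℝ × ℝ} {L : ℝ} (h : GoodPair φ ψ L) (γ : ℝ → ℝ × ℝ)
    (hγ : Continuous γ) (hS : ∀ s ∈ Set.Icc (0 : ℝ) 1, γ s ∈ USq)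
    (hb : ∀ s, 0 < s → s < 1 → ((γ s).1 = 0 ∨ (γ s).1 = 1) ∧ (0 < (γ s).2 ∧ (γ s).2 < 1) ∨
      (0 < (γ s).1 ∧ (γ s).1 < 1) ∧ ((γ s).2 = 0 ∨ (γ s).2 = 1))
    (α β δ : ℝ) (e : ℝ) (he : e = 0 ∨ e = 1)
    (hform : (α = 1 ∧ β = -1 ∧ δ = 0) ∨ (α = -1 ∧ β = 1 ∧ δ = 0) ∨ (α = 1 ∧ β = 1 ∧ δ = -1) ∨
      (α = -1 ∧ β = -1 ∧ δ = 1))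
    (hneg : α * (φ (γ e)).1 + β * (φ (γ e)).2 + δ < 0)
    (s : ℝ) (s0 : 0 < s) (s1 : s < 1) : α * (φ (γ s)).1 + β * (φ (γ s)).2 + δ < 0 := by
  have hc : ContinuousOn (fun s => φ (γ s)) (Set.Icc 0 1) :=
    h.cont.comp hγ.continuousOn hS
  refine sign_const (fun s => α * (φ (γ s)).1 + β * (φ (γ s)).2 + δ) ?_ ?_ e he hneg
    s s0 s1
  · exact ((continuousOn_const.mul hc.fst).add (continuousOn_const.mul hc.snd)).add
      continuousOn_const
  intro x x0 x1 hx
  have := diag_avoid h (γ x) (hS x ⟨x0.le, x1.le⟩) (hb x x0 x1)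
  rcases hform with ⟨rfl, rfl, rfl⟩ | ⟨rfl, rfl, rfl⟩ | ⟨rfl, rfl, rfl⟩ | ⟨rfl, rfl, rfl⟩
  · exact this.1 (by linarith)
  · exact this.1 (by linarith)
  · exact this.2 (by linarith)
  · exact this.2 (by linarith)

lemma edge_bottom {φ ψ : ℝ × ℝ → ℝ × ℝ} {L : ℝ} (h : GoodPair φ ψ L) (s : ℝ)
    (s0 : 0 ≤ s) (s1 : s ≤ 1) : (φ (s, 0)).2 = 0 := by
  rcases s0.eq_or_lt with rfl | s0
  · rw [h.v00]
  rcases s1.eq_or_lt with rfl | s1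
  · rw [h.v10]
  have aux := edge_aux h (fun s => (s, 0)) (by fun_prop)
    (fun s hs => mem_USq.2 ⟨hs, by simp⟩) (fun s a b => by simp [a, b])
  have A := aux 1 1 (-1) 0 (by simp) (by simp) (by simp [h.v00]) s s0 s1
  have B := aux (-1) 1 0 1 (by simp) (by simp) (by simp [h.v10]) s s0 s1
  have hS : ((s, 0) : ℝ × ℝ) ∈ USq := mem_USq.2 ⟨⟨s0.le, s1.le⟩, by simp⟩
  have w := mem_USq.1 (h.m1 _ hS)
  rcases bdry_map h (s, 0) hS (by simp) with b | b | b | b <;> linarith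

lemma edge_top {φ ψ : ℝ × ℝ → ℝ × ℝ} {L : ℝ} (h : GoodPair φ ψ L) (s : ℝ)
    (s0 : 0 ≤ s) (s1 : s ≤ 1) : (φ (s, 1)).2 = 1 := by
  rcases s0.eq_or_lt with rfl | s0
  · rw [h.v01]
  rcases s1.eq_or_lt with rfl | s1
  · rw [h.v11]
  have aux := edge_aux h (fun s => (s, 1)) (by fun_prop)
    (fun s hs => mem_USq.2 ⟨hs, by simp⟩) (fun s a b => by simp [a, b])
  have A := aux 1 (-1) 0 0 (by simp) (by simp) (by simp [h.v01]) s s0 s1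
  have B := aux (-1) (-1) 1 1 (by simp) (by simp) (by simp [h.v11]) s s0 s1
  have hS : ((s, 1) : ℝ × ℝ) ∈ USq := mem_USq.2 ⟨⟨s0.le, s1.le⟩, by simp⟩
  have w := mem_USq.1 (h.m1 _ hS)
  rcases bdry_map h (s, 1) hS (by simp) with b | b | b | b <;> linarith

lemma edge_right {φ ψ : ℝ × ℝ → ℝ × ℝ} {L : ℝ} (h : GoodPair φ ψ L) (s : ℝ)
    (s0 : 0 ≤ s) (s1 : s ≤ 1) : (φ (1, s)).1 = 1 := by
  rcases s0.eq_or_lt with rfl | s0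
  · rw [h.v10]
  rcases s1.eq_or_lt with rfl | s1
  · rw [h.v11]
  have aux := edge_aux h (fun s => (1, s)) (by fun_prop)
    (fun s hs => mem_USq.2 ⟨by simp, hs⟩) (fun s a b => by simp [a, b])
  have A := aux (-1) 1 0 0 (by simp) (by simp) (by simp [h.v10]) s s0 s1
  have B := aux (-1) (-1) 1 1 (by simp) (by simp) (by simp [h.v11]) s s0 s1
  have hS : ((1, s) : ℝ × ℝ) ∈ USq := mem_USq.2 ⟨by simp, ⟨s0.le, s1.le⟩⟩
  have w := mem_USq.1 (h.m1 _ hS)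
  rcases bdry_map h (1, s) hS (by simp) with b | b | b | b <;> linarith

/-- The rescaled, clamped point. -/
noncomputable def clampPt (a : (ℝ × ℝ) × ℝ) : ℝ × ℝ := (min a.1.1 a.2 / a.2, min a.1.2 a.2 / a.2)

/-- Alexander-type extension. -/
noncomputable def alex (φ : ℝ × ℝ → ℝ × ℝ) (a : (ℝ × ℝ) × ℝ) : (ℝ × ℝ) × ℝ :=
  ((a.2 * (φ (clampPt a)).1 + a.1.1 - min a.1.1 a.2,
    a.2 * (φ (clampPt a)).2 + a.1.2 - min a.1.2 a.2), a.2)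

/-- The unit cube. -/
def UCube : Set ((ℝ × ℝ) × ℝ) := USq ×ˢ Set.Icc (0 : ℝ) 1

lemma mem_UCube {a : (ℝ × ℝ) × ℝ} : a ∈ UCube ↔
    ((0 ≤ a.1.1 ∧ a.1.1 ≤ 1) ∧ (0 ≤ a.1.2 ∧ a.1.2 ≤ 1)) ∧ (0 ≤ a.2 ∧ a.2 ≤ 1) := by
  rw [UCube, Set.mem_prod, mem_USq, Set.mem_Icc]

lemma clampPt_mem {a : (ℝ × ℝ) × ℝ} (ha : a ∈ UCube) : clampPt a ∈ USq := by
  obtain ⟨⟨⟨x0, x1⟩, y0, y1⟩, t0, t1⟩ := mem_UCube.1 ha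
  rw [mem_USq]
  refine ⟨⟨?_, ?_⟩, ?_, ?_⟩ <;> simp only [clampPt]
  · exact div_nonneg (le_min x0 t0) t0
  · exact div_le_one_of_le₀ (min_le_right _ _) t0
  · exact div_nonneg (le_min y0 t0) t0
  · exact div_le_one_of_le₀ (min_le_right _ _) t0

lemma clamp_mul {x t : ℝ} (x0 : 0 ≤ x) (t0 : 0 ≤ t) : t * (min x t / t) = min x t := by
  rcases t0.eq_or_lt with rfl | t0
  · simp [x0]
  · field_simp

lemma alex_zero (φ : ℝ × ℝ → ℝ × ℝ) (p : ℝ × ℝ) (hp : p ∈ USq) : alex φ (p, 0) = (p, 0) := by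
  have := mem_USq.1 hp
  simp [alex, this.1.1, this.2.1]

lemma alex_one (φ : ℝ × ℝ → ℝ × ℝ) (p : ℝ × ℝ) (hp : p ∈ USq) : alex φ (p, 1) = (φ p, 1) := by
  have := mem_USq.1 hp
  simp [alex, clampPt, this.1.2, this.2.2]

/-- Behaviour of the coordinates of `alex` on the clamps. -/
lemma alex_min {φ ψ : ℝ × ℝ → ℝ × ℝ} {L : ℝ} (h : GoodPair φ ψ L) {a : (ℝ × ℝ) × ℝ}
    (ha : a ∈ UCube) (t0 : 0 < a.2) :
    ((a.1.1 ≤ a.2 ∧ min a.1.1 a.2 = a.1.1) ∨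
      (a.2 ≤ a.1.1 ∧ min a.1.1 a.2 = a.2 ∧ (φ (clampPt a)).1 = 1)) ∧
    ((a.1.2 ≤ a.2 ∧ min a.1.2 a.2 = a.1.2) ∨
      (a.2 ≤ a.1.2 ∧ min a.1.2 a.2 = a.2 ∧ (φ (clampPt a)).2 = 1)) := by
  have hm := mem_USq.1 (clampPt_mem ha)
  constructor
  · rcases le_total a.1.1 a.2 with hx | hx
    · exact Or.inl ⟨hx, min_eq_left hx⟩
    · refine Or.inr ⟨hx, min_eq_right hx, ?_⟩
      have e : clampPt a = (1, (clampPt a).2) := by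
        apply Prod.ext
        · simp [clampPt, min_eq_right hx, div_self t0.ne']
        · rfl
      rw [e]
      exact edge_right h _ hm.2.1 hm.2.2
  · rcases le_total a.1.2 a.2 with hx | hx
    · exact Or.inl ⟨hx, min_eq_left hx⟩
    · refine Or.inr ⟨hx, min_eq_right hx, ?_⟩
      have e : clampPt a = ((clampPt a).1, 1) := by
        apply Prod.ext
        · rfl
        · simp [clampPt, min_eq_right hx, div_self t0.ne']
      rw [e]
      exact edge_top h _ hm.1.1 hm.1.2

lemma alex_mem {φ ψ : ℝ × ℝ → ℝ × ℝ} {L : ℝ} (h : GoodPair φ ψ L) {a : (ℝ × ℝ) × ℝ}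
    (ha : a ∈ UCube) : alex φ a ∈ UCube := by
  obtain ⟨⟨⟨x0, x1⟩, y0, y1⟩, t0, t1⟩ := mem_UCube.1 ha
  rcases t0.eq_or_lt with t0 | t0
  · obtain ⟨p, t⟩ := a
    simp only at t0
    subst t0
    rwa [alex_zero φ p (mem_USq.2 ⟨⟨x0, x1⟩, y0, y1⟩)]
  · have w := mem_USq.1 (h.m1 _ (clampPt_mem ha))
    obtain ⟨A, B⟩ := alex_min h ha t0
    rw [mem_UCube]
    simp only [alex]
    refine ⟨⟨?_, ?_⟩, t0.le, t1⟩
    · rcases A with ⟨_, A⟩ | ⟨_, A, A'⟩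
      · rw [A]; constructor <;> nlinarith
      · rw [A, A']; constructor <;> linarith
    · rcases B with ⟨_, A⟩ | ⟨_, A, A'⟩
      · rw [A]; constructor <;> nlinarith
      · rw [A, A']; constructor <;> linarith

lemma alex_inv {φ ψ : ℝ × ℝ → ℝ × ℝ} {L : ℝ} (h : GoodPair φ ψ L) {a : (ℝ × ℝ) × ℝ}
    (ha : a ∈ UCube) : alex ψ (alex φ a) = a := by
  obtain ⟨⟨⟨x0, x1⟩, y0, y1⟩, t0, t1⟩ := mem_UCube.1 ha
  rcases t0.eq_or_lt with t0 | t0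
  · obtain ⟨p, t⟩ := a
    simp only at t0
    subst t0
    have hp := mem_USq.2 ⟨⟨x0, x1⟩, y0, y1⟩
    rw [alex_zero φ p hp, alex_zero ψ p hp]
  · have w := mem_USq.1 (h.m1 _ (clampPt_mem ha))
    obtain ⟨A, B⟩ := alex_min h ha t0
    have e1 : min (alex φ a).1.1 a.2 = a.2 * (φ (clampPt a)).1 := by
      simp only [alex]
      rcases A with ⟨_, A⟩ | ⟨A0, A, A'⟩
      · rw [A, min_eq_left] <;> nlinarith
      · rw [A, A', min_eq_right] <;> linarith
    have e2 : min (alex φ a).1.2 a.2 = a.2 * (φ (clampPt a)).2 := by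
      simp only [alex]
      rcases B with ⟨_, A⟩ | ⟨A0, A, A'⟩
      · rw [A, min_eq_left] <;> nlinarith
      · rw [A, A', min_eq_right] <;> linarith
    have e3 : (alex φ a).2 = a.2 := rfl
    have e4 : clampPt (alex φ a) = φ (clampPt a) := by
      rw [clampPt, e3, e1, e2]
      apply Prod.ext <;> simp only <;> field_simp
    have e5 : alex ψ (alex φ a) =
      ((a.2 * (ψ (φ (clampPt a))).1 + (alex φ a).1.1 - a.2 * (φ (clampPt a)).1,
        a.2 * (ψ (φ (clampPt a))).2 + (alex φ a).1.2 - a.2 * (φ (clampPt a)).2), a.2) := by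
      conv_lhs => rw [alex, e4, e3, e1, e2]
    rw [e5, h.i1 _ (clampPt_mem ha)]
    have c1 := clamp_mul x0 t0.le
    have c2 := clamp_mul y0 t0.le
    refine Prod.ext (Prod.ext ?_ ?_) rfl
    · simp only [alex, clampPt, c1]; ring
    · simp only [alex, clampPt, c2]; ring

lemma dist_le_iff2 {p q : ℝ × ℝ} {d : ℝ} :
    dist p q ≤ d ↔ |p.1 - q.1| ≤ d ∧ |p.2 - q.2| ≤ d := by
  rw [Prod.dist_eq, max_le_iff, Real.dist_eq, Real.dist_eq]

lemma abs_min_sub {x y t s d : ℝ} (h1 : |x - y| ≤ d) (h2 : |t - s| ≤ d) :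
    |min x t - min y s| ≤ d :=
  (abs_min_sub_min_le_max x t y s).trans (max_le h1 h2)

/-- Main scalar estimate. -/
lemma scalar_est {P Q s t d : ℝ} (s0 : 0 ≤ s) (hst : |t - s| ≤ d)
    (P0 : 0 ≤ P) (P1 : P ≤ 1) (h : |t * P - s * Q| ≤ d) : s * |P - Q| ≤ 2 * d := by
  have : s * |P - Q| = |s * (P - Q)| := by rw [abs_mul, abs_of_nonneg s0]
  rw [this]
  have e : s * (P - Q) = (t * P - s * Q) - (t - s) * P := by ring
  rw [e]
  have h3 : |(t - s) * P| ≤ d := by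
    rw [abs_mul, abs_of_nonneg P0]
    nlinarith [abs_nonneg (t - s)]
  have := abs_sub (t * P - s * Q) ((t - s) * P)
  linarith

lemma scalar_est2 {F G s t d K x y m n : ℝ} (s0 : 0 ≤ s) (hst : |t - s| ≤ d)
    (F0 : 0 ≤ F) (F1 : F ≤ 1) (h : s * |F - G| ≤ K) (hx : |x - y| ≤ d) (hm : |m - n| ≤ d) :
    |(t * F + x - m) - (s * G + y - n)| ≤ K + 3 * d := by
  have e : (t * F + x - m) - (s * G + y - n) = (t - s) * F + s * (F - G) + (x - y) - (m - n) := by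
    ring
  rw [e]
  have h3 : |(t - s) * F| ≤ d := by
    rw [abs_mul, abs_of_nonneg F0]
    nlinarith [abs_nonneg (t - s)]
  have h4 : |s * (F - G)| ≤ K := by rwa [abs_mul, abs_of_nonneg s0]
  rw [abs_le] at *
  constructor <;> linarith [h3.1, h3.2, h4.1, h4.2, hx.1, hx.2, hm.1, hm.2]

lemma alex_lip {φ ψ : ℝ × ℝ → ℝ × ℝ} {L : ℝ} (h : GoodPair φ ψ L) {a b : (ℝ × ℝ) × ℝ}
    (ha : a ∈ UCube) (hb : b ∈ UCube) :
    dist (alex φ a) (alex φ b) ≤ (2 * L + 3) * dist a b := by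
  obtain ⟨⟨⟨x0, x1⟩, y0, y1⟩, t0, t1⟩ := mem_UCube.1 ha
  obtain ⟨⟨⟨x0', x1'⟩, y0', y1'⟩, t0', t1'⟩ := mem_UCube.1 hb
  have hL := h.hL
  obtain ⟨d, hd⟩ : ∃ d, d = dist a b := ⟨_, rfl⟩
  have hd0 : 0 ≤ d := hd ▸ dist_nonneg
  have h1 : dist a.1 b.1 ≤ d := by rw [hd, Prod.dist_eq]; exact le_max_left _ _
  have h2 : |a.2 - b.2| ≤ d := by rw [hd, Prod.dist_eq, ← Real.dist_eq]; exact le_max_right _ _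
  obtain ⟨hx, hy⟩ := dist_le_iff2.1 h1
  have hmx := abs_min_sub hx h2
  have hmy := abs_min_sub hy h2
  have mP := clampPt_mem ha
  have mQ := clampPt_mem hb
  have wP := mem_USq.1 mP
  have wF := mem_USq.1 (h.m1 _ mP)
  have k1 : b.2 * |(clampPt a).1 - (clampPt b).1| ≤ 2 * d := by
    refine scalar_est t0' h2 wP.1.1 wP.1.2 ?_
    simp only [clampPt]
    rwa [clamp_mul x0 t0, clamp_mul x0' t0']
  have k2 : b.2 * |(clampPt a).2 - (clampPt b).2| ≤ 2 * d := by
    refine scalar_est t0' h2 wP.2.1 wP.2.2 ?_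
    simp only [clampPt]
    rwa [clamp_mul y0 t0, clamp_mul y0' t0']
  have k3 : b.2 * dist (clampPt a) (clampPt b) ≤ 2 * d := by
    rw [Prod.dist_eq, Real.dist_eq, Real.dist_eq]
    rcases max_cases |(clampPt a).1 - (clampPt b).1| |(clampPt a).2 - (clampPt b).2| with
      ⟨e, -⟩ | ⟨e, -⟩ <;> rw [e] <;> assumption
  have k4 : b.2 * dist (φ (clampPt a)) (φ (clampPt b)) ≤ 2 * L * d := by
    have := mul_le_mul_of_nonneg_left (h.l1 _ mP _ mQ) t0'
    nlinarith
  obtain ⟨g1, g2⟩ := dist_le_iff2.1 (le_refl (dist (φ (clampPt a)) (φ (clampPt b))))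
  have g1' := (mul_le_mul_of_nonneg_left g1 t0').trans k4
  have g2' := (mul_le_mul_of_nonneg_left g2 t0').trans k4
  rw [← hd, Prod.dist_eq]
  apply max_le
  · rw [dist_le_iff2]
    constructor
    · exact (scalar_est2 t0' h2 wF.1.1 wF.1.2 g1' hx hmx).trans (by linarith)
    · exact (scalar_est2 t0' h2 wF.2.1 wF.2.2 g2' hy hmy).trans (by linarith)
  · rw [Real.dist_eq]
    exact h2.trans (by nlinarith)

/-- Every bi-Lipschitz self-homeomorphism `φ` of the unit square fixing the four
vertices extends to a bi-Lipschitz self-homeomorphism `Φ` of the unit cube which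
is the identity on the bottom face `[0,1]² × {0}` and equals `φ` on the top face
`[0,1]² × {1}`. -/
theorem square_biLipschitz_isotopic_to_id (φ : ℝ × ℝ → ℝ × ℝ) (L : ℝ) (hL : 1 ≤ L)
    (hbij : Set.BijOn φ (Set.Icc (0 : ℝ) 1 ×ˢ Set.Icc (0 : ℝ) 1)
      (Set.Icc (0 : ℝ) 1 ×ˢ Set.Icc (0 : ℝ) 1))
    (hlip : ∀ p ∈ Set.Icc (0 : ℝ) 1 ×ˢ Set.Icc (0 : ℝ) 1,
      ∀ q ∈ Set.Icc (0 : ℝ) 1 ×ˢ Set.Icc (0 : ℝ) 1,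
        dist p q / L ≤ dist (φ p) (φ q) ∧ dist (φ p) (φ q) ≤ L * dist p q)
    (h00 : φ (0, 0) = (0, 0)) (h10 : φ (1, 0) = (1, 0))
    (h01 : φ (0, 1) = (0, 1)) (h11 : φ (1, 1) = (1, 1)) :
    ∃ (Φ : (ℝ × ℝ) × ℝ → (ℝ × ℝ) × ℝ) (L' : ℝ), 1 ≤ L' ∧
      Set.BijOn Φ ((Set.Icc (0 : ℝ) 1 ×ˢ Set.Icc (0 : ℝ) 1) ×ˢ Set.Icc (0 : ℝ) 1)
        ((Set.Icc (0 : ℝ) 1 ×ˢ Set.Icc (0 : ℝ) 1) ×ˢ Set.Icc (0 : ℝ) 1) ∧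
      (∀ p ∈ Set.Icc (0 : ℝ) 1 ×ˢ Set.Icc (0 : ℝ) 1, Φ (p, 0) = (p, 0)) ∧
      (∀ p ∈ Set.Icc (0 : ℝ) 1 ×ˢ Set.Icc (0 : ℝ) 1, Φ (p, 1) = (φ p, 1)) ∧
      ∀ a ∈ (Set.Icc (0 : ℝ) 1 ×ˢ Set.Icc (0 : ℝ) 1) ×ˢ Set.Icc (0 : ℝ) 1,
        ∀ b ∈ (Set.Icc (0 : ℝ) 1 ×ˢ Set.Icc (0 : ℝ) 1) ×ˢ Set.Icc (0 : ℝ) 1,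
          dist a b / L' ≤ dist (Φ a) (Φ b) ∧ dist (Φ a) (Φ b) ≤ L' * dist a b := by
  have hL0 : 0 < L := by linarith
  have hm : ∀ p ∈ USq, Function.invFunOn φ USq p ∈ USq ∧ φ (Function.invFunOn φ USq p) = p := by
    intro p hp
    have := hbij.surjOn hp
    exact ⟨Function.invFunOn_mem this, Function.invFunOn_eq this⟩
  have G : GoodPair φ (Function.invFunOn φ USq) L :=
    { hL := hL
      m1 := fun p hp => hbij.mapsTo hp
      m2 := fun p hp => (hm p hp).1
      i1 := fun p hp => hbij.injOn (hm _ (hbij.mapsTo hp)).1 hp (hm _ (hbij.mapsTo hp)).2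
      i2 := fun p hp => (hm p hp).2
      l1 := fun p hp q hq => (hlip p hp q hq).2
      l2 := fun p hp q hq => by
        have := (hlip _ (hm p hp).1 _ (hm q hq).1).1
        rw [(hm p hp).2, (hm q hq).2, div_le_iff₀ hL0] at this
        linarith
      v00 := h00
      v10 := h10
      v01 := h01
      v11 := h11 }
  have hK : 0 < 2 * L + 3 := by linarith
  refine ⟨alex φ, 2 * L + 3, by linarith, ⟨fun a ha => alex_mem G ha, ?_, ?_⟩, ?_, ?_, ?_⟩
  · intro a ha b hb e
    rw [← alex_inv G ha, e, alex_inv G hb]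
  · intro a ha
    exact ⟨_, alex_mem G.symm ha, alex_inv G.symm ha⟩
  · exact fun p hp => alex_zero φ p hp
  · exact fun p hp => alex_one φ p hp
  · intro a ha b hb
    refine ⟨?_, alex_lip G ha hb⟩
    have := alex_lip G.symm (alex_mem G ha) (alex_mem G hb)
    rw [alex_inv G ha, alex_inv G hb] at this
    rw [div_le_iff₀ hK]
    linarith
end

section
/- Let X be a metric space, let L ≥ 1 and 0 < m ≤ M. Let φ : [0,1]² → X be L-bi-Lipschitz and let ρ₀, ρ₁ : X → ℝ be L-Lipschitz functions satisfying ρ₀(x) + m ≤ ρ₁(x) ≤ ρ₀(x) + M for all x ∈ X. Define φ̄ : [0,1]³ → X × ℝ by φ̄(x,t) := (φ(x), (1−t)·ρ₀(φ(x)) + t·ρ₁(φ(x))) for x ∈ [0,1]², t ∈ [0,1], where X × ℝ carries the maximum metric. Then φ̄ is L̄-bi-Lipschitz onto its image for some constant L̄ depending only on L, M, and m. -/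
universe u

/-- Extension lemma (Lemma `prism1`): given an `L`-bi-Lipschitz map
`φ : [0,1]² → X` and `L`-Lipschitz functions `ρ₀, ρ₁ : X → ℝ` with
`ρ₀ + m ≤ ρ₁ ≤ ρ₀ + M` (`0 < m ≤ M`), the map
`φ̄(x,t) = (φ(x), (1−t)ρ₀(φ(x)) + tρ₁(φ(x)))` from `[0,1]³` to `X × ℝ`
(maximum metric) is `L̄`-bi-Lipschitz onto its image, with `L̄` depending only
on `L`, `M`, `m`. -/
theorem prism_extension_biLipschitz (L M m : ℝ) (hL : 1 ≤ L) (hm : 0 < m) (hmM : m ≤ M) :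
    ∃ Lbar : ℝ, 1 ≤ Lbar ∧
      ∀ (X : Type u) [MetricSpace X],
        ∀ (φ : ℝ × ℝ → X) (ρ₀ ρ₁ : X → ℝ),
          (∀ p ∈ Set.Icc (0 : ℝ) 1 ×ˢ Set.Icc (0 : ℝ) 1,
            ∀ q ∈ Set.Icc (0 : ℝ) 1 ×ˢ Set.Icc (0 : ℝ) 1,
              dist p q / L ≤ dist (φ p) (φ q) ∧ dist (φ p) (φ q) ≤ L * dist p q) →
          (∀ x y : X, |ρ₀ x - ρ₀ y| ≤ L * dist x y) →
          (∀ x y : X, |ρ₁ x - ρ₁ y| ≤ L * dist x y) →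
          (∀ x : X, ρ₀ x + m ≤ ρ₁ x ∧ ρ₁ x ≤ ρ₀ x + M) →
          ∀ Φ : (ℝ × ℝ) × ℝ → X × ℝ,
            (∀ (p : ℝ × ℝ) (t : ℝ),
              Φ (p, t) = (φ p, (1 - t) * ρ₀ (φ p) + t * ρ₁ (φ p))) →
            ∀ a ∈ (Set.Icc (0 : ℝ) 1 ×ˢ Set.Icc (0 : ℝ) 1) ×ˢ Set.Icc (0 : ℝ) 1,
              ∀ b ∈ (Set.Icc (0 : ℝ) 1 ×ˢ Set.Icc (0 : ℝ) 1) ×ˢ Set.Icc (0 : ℝ) 1,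
                dist a b / Lbar ≤ dist (Φ a) (Φ b) ∧ dist (Φ a) (Φ b) ≤ Lbar * dist a b := by
  have hK : 0 < (1 + L) / m := by positivity
  refine ⟨L ^ 2 + L + M + (1 + L) / m, by nlinarith, ?_⟩
  intro X _ φ ρ₀ ρ₁ hφ h0 h1 hρ Φ hΦ a ha b hb
  obtain ⟨p, s⟩ := a
  obtain ⟨q, t⟩ := b
  obtain ⟨hp, hs⟩ := ha
  obtain ⟨hq, ht⟩ := hb
  obtain ⟨hlo, hhi⟩ := hφ p hp q hq
  obtain ⟨hs0, hs1⟩ := hs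
  obtain ⟨ht0, ht1⟩ := ht
  simp only at hs0 hs1 ht0 ht1 hp hq
  rw [hΦ, hΦ, Prod.dist_eq (x := (φ p, _)), Prod.dist_eq (x := (p, s))]
  simp only [Real.dist_eq]
  have h0' := h0 (φ p) (φ q)
  have h1' := h1 (φ p) (φ q)
  obtain ⟨r0, r1⟩ := hρ (φ q)
  have hD : 0 ≤ dist (φ p) (φ q) := dist_nonneg
  have hd : 0 ≤ dist p q := dist_nonneg
  have hlo' : dist p q ≤ L * dist (φ p) (φ q) := by
    rw [div_le_iff₀ (by linarith)] at hlo
    linarith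
  generalize dist (φ p) (φ q) = D at *
  generalize dist p q = d at *
  -- the part of the height difference controlled by the Lipschitz functions
  have hA : |(1 - s) * (ρ₀ (φ p) - ρ₀ (φ q)) + s * (ρ₁ (φ p) - ρ₁ (φ q))| ≤ L * D := by
    rw [abs_le] at h0' h1' ⊢
    constructor <;> nlinarith
  have hdec : (1 - s) * ρ₀ (φ p) + s * ρ₁ (φ p) - ((1 - t) * ρ₀ (φ q) + t * ρ₁ (φ q))
      = ((1 - s) * (ρ₀ (φ p) - ρ₀ (φ q)) + s * (ρ₁ (φ p) - ρ₁ (φ q)))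
        + (s - t) * (ρ₁ (φ q) - ρ₀ (φ q)) := by ring
  rw [hdec]
  generalize (1 - s) * (ρ₀ (φ p) - ρ₀ (φ q)) + s * (ρ₁ (φ p) - ρ₁ (φ q)) = A at *
  have hw : |(s - t) * (ρ₁ (φ q) - ρ₀ (φ q))| = |s - t| * (ρ₁ (φ q) - ρ₀ (φ q)) := by
    rw [abs_mul, abs_of_nonneg (a := ρ₁ (φ q) - ρ₀ (φ q)) (by linarith)]
  have hu : 0 ≤ |s - t| := abs_nonneg _
  have hup := abs_add_le A ((s - t) * (ρ₁ (φ q) - ρ₀ (φ q)))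
  have hdn := abs_sub (A + (s - t) * (ρ₁ (φ q) - ρ₀ (φ q))) A
  rw [add_sub_cancel_left] at hdn
  rw [hw] at hup hdn
  generalize |A + (s - t) * (ρ₁ (φ q) - ρ₀ (φ q))| = H at *
  generalize |s - t| = u at *
  have g0 : m ≤ ρ₁ (φ q) - ρ₀ (φ q) := by linarith
  have g1 : ρ₁ (φ q) - ρ₀ (φ q) ≤ M := by linarith
  generalize ρ₁ (φ q) - ρ₀ (φ q) = w at *
  have hwm : m * u ≤ u * w := by nlinarith
  have hwM : u * w ≤ M * u := by nlinarith
  constructor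
  · rw [div_le_iff₀ (by nlinarith)]
    have e1 : D ≤ max D H := le_max_left _ _
    have e2 : H ≤ max D H := le_max_right _ _
    generalize max D H = E at *
    have hE : 0 ≤ E := hD.trans e1
    have k1 : 0 ≤ E * L ^ 2 := by positivity
    have k2 : 0 ≤ E * L := by positivity
    have k3 : 0 ≤ E * M := mul_nonneg hE (by linarith)
    have k4 : 0 ≤ E * ((1 + L) / m) := by positivity
    have k5 : L * D ≤ L * E := by gcongr
    apply max_le
    · nlinarith
    · have : u ≤ E * ((1 + L) / m) := by
        rw [← mul_div_assoc, le_div_iff₀ hm]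
        nlinarith
      nlinarith
  · have e1 : d ≤ max d u := le_max_left _ _
    have e2 : u ≤ max d u := le_max_right _ _
    generalize max d u = E at *
    have hE : 0 ≤ E := hd.trans e1
    have k1 : 0 ≤ L ^ 2 * E := by positivity
    have k2 : 0 ≤ L * E := by positivity
    have k3 : 0 ≤ M * E := mul_nonneg (by linarith) hE
    have k4 : 0 ≤ (1 + L) / m * E := by positivity
    have k5 : L * d ≤ L * E := by gcongr
    have k6 : L * D ≤ L * (L * E) := by gcongr; linarith
    have k7 : M * u ≤ M * E := mul_le_mul_of_nonneg_left e2 (by linarith)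
    have e : (L ^ 2 + L + M + (1 + L) / m) * E
        = L * (L * E) + L * E + M * E + (1 + L) / m * E := by ring
    have k8 : 0 ≤ L * (L * E) := by positivity
    rw [e]
    apply max_le
    · linarith
    · linarith
end
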